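/- Assume hypotheses (R1) and (L1). Then for all j,k ∈ {1,…,n−1} and all first-order Wirtinger directions ∂_A, ∂_B ∈ {∂/∂z_1,…,∂/∂z_n, ∂/∂z̄_1,…,∂/∂z̄_n}, at every point of L one has the fourth-derivative identity u_{jk̄AB} = (u_{nn̄})^{−1} [ u_{nk̄A} u_{jn̄B} + u_{nk̄B} u_{jn̄A} ]. Moreover u_{jk̄AB} = 0 at every point of L unless both ∂_A and ∂_B belong to {∂/∂z_n, ∂/∂z̄_n}. -/

import Mathlib

open Complex
open scoped ComplexOrder

/-- Wirtinger derivative in direction `d.1`; `d.2 = true` means `∂/∂z̄`, `false` means `∂/∂z`. -/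
noncomputable def wd {n : ℕ} (d : Fin n × Bool) (f : (Fin n → ℂ) → ℂ) : (Fin n → ℂ) → ℂ :=
  fun z => (1/2 : ℂ) * (fderiv ℝ f z (Pi.single d.1 1) +
      (if d.2 then Complex.I else -Complex.I) * fderiv ℝ f z (Pi.single d.1 Complex.I))

/-- Iterated Wirtinger derivative: differentiate in the listed directions, left to right. -/
noncomputable def wderiv {n : ℕ} (l : List (Fin n × Bool)) (f : (Fin n → ℂ) → ℂ) :
    (Fin n → ℂ) → ℂ :=
  l.foldl (fun g d => wd d g) f

/-- The real function `u` viewed as a complex-valued function. -/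
def cplx {n : ℕ} (u : (Fin n → ℂ) → ℝ) : (Fin n → ℂ) → ℂ := fun z => (u z : ℂ)

/-- Levi matrix entry `u_{jk̄} = ∂²u/∂z_j∂z̄_k`. -/
noncomputable def levi {n : ℕ} (u : (Fin n → ℂ) → ℝ) (j k : Fin n) : (Fin n → ℂ) → ℂ :=
  wderiv [(j, false), (k, true)] (cplx u)

theorem wd_smooth {n : ℕ} {U : Set (Fin n → ℂ)} (hU : IsOpen U) {f : (Fin n → ℂ) → ℂ}
    (hf : ContDiffOn ℝ (⊤ : ℕ∞) f U) (d : Fin n × Bool) :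
    ContDiffOn ℝ (⊤ : ℕ∞) (wd d f) U := by
  have h1 : ContDiffOn ℝ (⊤ : ℕ∞) (fderiv ℝ f) U := hf.fderiv_of_isOpen hU (by simp)
  unfold wd
  exact contDiffOn_const.mul ((h1.clm_apply contDiffOn_const).add
    (contDiffOn_const.mul (h1.clm_apply contDiffOn_const)))

theorem smooth_da {n : ℕ} {U : Set (Fin n → ℂ)} (hU : IsOpen U) {f : (Fin n → ℂ) → ℂ}
    (hf : ContDiffOn ℝ (⊤ : ℕ∞) f U) {z : Fin n → ℂ} (hz : z ∈ U) :
    DifferentiableAt ℝ f z :=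
  (hf.contDiffAt (hU.mem_nhds hz)).differentiableAt (by simp)

theorem wd_mul {n : ℕ} {f g : (Fin n → ℂ) → ℂ} {z : Fin n → ℂ}
    (hf : DifferentiableAt ℝ f z) (hg : DifferentiableAt ℝ g z) (d : Fin n × Bool) :
    wd d (fun w => f w * g w) z = wd d f z * g z + f z * wd d g z := by
  unfold wd
  rw [fderiv_fun_mul hf hg]
  simp only [ContinuousLinearMap.add_apply, ContinuousLinearMap.smul_apply, smul_eq_mul]
  ring

theorem wd_add {n : ℕ} {f g : (Fin n → ℂ) → ℂ} {z : Fin n → ℂ}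
    (hf : DifferentiableAt ℝ f z) (hg : DifferentiableAt ℝ g z) (d : Fin n × Bool) :
    wd d (fun w => f w + g w) z = wd d f z + wd d g z := by
  unfold wd
  rw [fderiv_fun_add hf hg]
  simp only [ContinuousLinearMap.add_apply]
  ring

theorem wd_congr {n : ℕ} {U : Set (Fin n → ℂ)} (hU : IsOpen U) {f g : (Fin n → ℂ) → ℂ}
    (h : ∀ z ∈ U, f z = g z) (d : Fin n × Bool) : ∀ z ∈ U, wd d f z = wd d g z := by
  intro z hz
  have : f =ᶠ[nhds z] g := by
    filter_upwards [hU.mem_nhds hz] with w hw using h w hw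
  unfold wd
  rw [this.fderiv_eq]

theorem wd_mul2 {n : ℕ} {U : Set (Fin n → ℂ)} (hU : IsOpen U) {f g : (Fin n → ℂ) → ℂ}
    (hf : ContDiffOn ℝ (⊤ : ℕ∞) f U) (hg : ContDiffOn ℝ (⊤ : ℕ∞) g U) (A B : Fin n × Bool)
    {z : Fin n → ℂ} (hz : z ∈ U) :
    wd B (wd A (fun w => f w * g w)) z =
      wd B (wd A f) z * g z + wd A f z * wd B g z + wd B f z * wd A g z
        + f z * wd B (wd A g) z := by
  rw [wd_congr hU (g := fun w => wd A f w * g w + f w * wd A g w)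
    (fun w hw => wd_mul (smooth_da hU hf hw) (smooth_da hU hg hw) A) B z hz]
  have a1 := smooth_da hU hf hz
  have a2 := smooth_da hU hg hz
  have a3 := smooth_da hU (wd_smooth hU hf A) hz
  have a4 := smooth_da hU (wd_smooth hU hg A) hz
  rw [wd_add (f := fun w => wd A f w * g w) (g := fun w => f w * wd A g w)
    (a3.mul a2) (a1.mul a4), wd_mul a3 a2, wd_mul a1 a4]
  ring

/-- A function vanishing on the leaf has vanishing tangential derivatives there. -/
theorem wd_tangent {n : ℕ} {U : Set (Fin n → ℂ)} (hU : IsOpen U) {f : (Fin n → ℂ) → ℂ}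
    (hf : ContDiffOn ℝ (⊤ : ℕ∞) f U) (l : Fin n) (h : ∀ z ∈ U, z l = 0 → f z = 0)
    (d : Fin n × Bool) (hd : d.1 ≠ l) {z : Fin n → ℂ} (hz : z ∈ U) (hl : z l = 0) :
    wd d f z = 0 := by
  have key : ∀ c : ℂ, fderiv ℝ f z (Pi.single d.1 c) = 0 := by
    intro c
    have hda := smooth_da hU hf hz
    rw [← hda.lineDeriv_eq_fderiv]
    unfold lineDeriv
    have hc : Continuous (fun t : ℝ => z + t • (Pi.single d.1 c : Fin n → ℂ)) := by fun_prop
    have : (fun t : ℝ => f (z + t • (Pi.single d.1 c : Fin n → ℂ))) =ᶠ[nhds 0] fun _ => 0 := by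
      have hm := hc.continuousAt.preimage_mem_nhds (x := (0 : ℝ)) (t := U)
        (by simpa using hU.mem_nhds hz)
      filter_upwards [hm] with t ht
      apply h _ ht
      simp [hl, Pi.single_eq_of_ne hd.symm]
    rw [this.deriv_eq]
    simp
  unfold wd
  rw [key, key]
  simp

/-- under (R1) and (L1), along L = {z_n = 0},
u_{jk̄AB} = (u_{nn̄})⁻¹ [u_{nk̄A} u_{jn̄B} + u_{nk̄B} u_{jn̄A}], and u_{jk̄AB} = 0
unless both directions A, B have index n. -/
theorem stmt_4 {m : ℕ} (hm : 1 ≤ m) (U : Set (Fin (m+1) → ℂ)) (hU : IsOpen U)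
    (u : (Fin (m+1) → ℂ) → ℝ) (hsmooth : ContDiffOn ℝ (⊤ : ℕ∞) u U)
    (hR1 : ∀ z ∈ U, ∀ j k : Fin (m+1), j ≠ Fin.last m → k ≠ Fin.last m →
      levi u j k z * levi u (Fin.last m) (Fin.last m) z
        - levi u j (Fin.last m) z * levi u (Fin.last m) k z = 0)
    (hL1 : ∀ z ∈ U, z (Fin.last m) = 0 →
      (∀ j k : Fin (m+1), (j, k) ≠ (Fin.last m, Fin.last m) → levi u j k z = 0) ∧
      0 < (levi u (Fin.last m) (Fin.last m) z).re ∧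
      (levi u (Fin.last m) (Fin.last m) z).im = 0) :
    ∀ z ∈ U, z (Fin.last m) = 0 →
      ∀ j k : Fin (m+1), j ≠ Fin.last m → k ≠ Fin.last m →
      ∀ A B : Fin (m+1) × Bool,
        (wderiv [(j, false), (k, true), A, B] (cplx u) z
          = (levi u (Fin.last m) (Fin.last m) z)⁻¹
            * (wderiv [(Fin.last m, false), (k, true), A] (cplx u) z
                  * wderiv [(j, false), (Fin.last m, true), B] (cplx u) z
                + wderiv [(Fin.last m, false), (k, true), B] (cplx u) z
                  * wderiv [(j, false), (Fin.last m, true), A] (cplx u) z)) ∧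
        (¬(A.1 = Fin.last m ∧ B.1 = Fin.last m) →
          wderiv [(j, false), (k, true), A, B] (cplx u) z = 0) := by
  have hc : ContDiffOn ℝ (⊤ : ℕ∞) (cplx u) U :=
    Complex.ofRealCLM.contDiff.comp_contDiffOn hsmooth
  have hlev : ∀ j k, ContDiffOn ℝ (⊤ : ℕ∞) (levi u j k) U := fun j k =>
    wd_smooth hU (wd_smooth hU hc _) _
  intro z hz hzl j k hj hk A B
  set l := Fin.last m with hldef
  have e3 : ∀ a b C, wderiv [(a, false), (b, true), C] (cplx u) = wd C (levi u a b) :=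
    fun a b C => rfl
  have e4 : wderiv [(j, false), (k, true), A, B] (cplx u) = wd B (wd A (levi u j k)) := rfl
  rw [e4, e3, e3, e3, e3]
  have vjk := fun w hw hwl => (hL1 w hw hwl).1 j k (by simp [hj])
  have vjl := fun w hw hwl => (hL1 w hw hwl).1 j l (by simp [hj])
  have vlk := fun w hw hwl => (hL1 w hw hwl).1 l k (by simp [hk])
  have hne : levi u l l z ≠ 0 := by
    intro h0
    have := (hL1 z hz hzl).2.1
    rw [h0] at this
    simp at this
  have heq : ∀ w ∈ U, (fun w => levi u j k w * levi u l l w) w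
      = (fun w => levi u j l w * levi u l k w) w := fun w hw => sub_eq_zero.mp (hR1 w hw j k hj hk)
  have first : ∀ C, wd C (levi u j k) z = 0 := by
    intro C
    have h := wd_congr hU heq C z hz
    rw [wd_mul (smooth_da hU (hlev _ _) hz) (smooth_da hU (hlev _ _) hz),
      wd_mul (smooth_da hU (hlev _ _) hz) (smooth_da hU (hlev _ _) hz),
      vjk z hz hzl, vjl z hz hzl, vlk z hz hzl] at h
    simpa [hne] using h
  have h2 := wd_congr hU (wd_congr hU heq A) B z hz
  rw [wd_mul2 hU (hlev _ _) (hlev _ _) A B hz, wd_mul2 hU (hlev _ _) (hlev _ _) A B hz,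
    first A, first B, vjk z hz hzl, vjl z hz hzl, vlk z hz hzl] at h2
  have main : wd B (wd A (levi u j k)) z = (levi u l l z)⁻¹ *
      (wd A (levi u l k) z * wd B (levi u j l) z + wd B (levi u l k) z * wd A (levi u j l) z) := by
    rw [eq_inv_mul_iff_mul_eq₀ hne]
    linear_combination h2
  refine ⟨main, fun hAB => ?_⟩
  rw [main]
  have t : ∀ C : Fin (m+1) × Bool, C.1 ≠ l →
      wd C (levi u l k) z = 0 ∧ wd C (levi u j l) z = 0 := fun C hC =>
    ⟨wd_tangent hU (hlev _ _) l vlk C hC hz hzl, wd_tangent hU (hlev _ _) l vjl C hC hz hzl⟩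
  by_cases hA : A.1 = l
  · have hB : B.1 ≠ l := fun hB => hAB ⟨hA, hB⟩
    simp [t B hB]
  · simp [t A hA]
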